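/- arXiv:1812.03095 — 2 statements merged into one kernel-verified Lean document; each statement's English description precedes it below -/
import Mathlib

section
/- Let ψ be an admissible obstacle and let γ ∈ P_ψ be a ∩-shaped pseudograph, concave on the top, which touches the obstacle, i.e. whose graph reparametrization u satisfies u(x₀) = ψ(x₀) for some x₀ ∈ (0,1). Then L(γ) ≤ 2·(sup_{x∈(0,1)} ψ(x) + ‖ψ'‖_∞) + 1. -/
open MeasureTheory Set Topology Filter

noncomputable section

/-- A function of class `W^{2,2}(0,1)`, identified with its `C¹([0,1])` representative:
`u` has weak derivatives `du`, `ddu` (encoded through the fundamental theorem of calculus)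
with `du, ddu ∈ L¹(0,1)` and `ddu ∈ L²(0,1)`. -/
structure W22 where
  u : ℝ → ℝ
  du : ℝ → ℝ
  ddu : ℝ → ℝ
  du_int : IntegrableOn du (Icc (0:ℝ) 1)
  ddu_int : IntegrableOn ddu (Icc (0:ℝ) 1)
  ddu_sq : IntegrableOn (fun x => (ddu x)^2) (Icc (0:ℝ) 1)
  ftc_u : ∀ x ∈ Icc (0:ℝ) 1, u x = u 0 + ∫ s in (0:ℝ)..x, du s
  ftc_du : ∀ x ∈ Icc (0:ℝ) 1, du x = du 0 + ∫ s in (0:ℝ)..x, ddu s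

/-- The elastic energy of a graph. -/
def graphE (f : W22) : ℝ :=
  ∫ x in Ioo (0:ℝ) 1, (f.ddu x)^2 / (1 + (f.du x)^2) ^ ((5:ℝ)/2)

/-- The length of a graph. -/
def graphLen (f : W22) : ℝ :=
  ∫ x in Ioo (0:ℝ) 1, Real.sqrt (1 + (f.du x)^2)

/-- The length-penalized elastic energy of a graph. -/
def graphPE (ε : ℝ) (f : W22) : ℝ := graphE f + ε * graphLen f

/-- Membership in the admissible class `G_ψ`. -/
def MemG (ψ : ℝ → ℝ) (f : W22) : Prop :=
  f.u 0 = 0 ∧ f.u 1 = 0 ∧ ∀ x ∈ Icc (0:ℝ) 1, ψ x ≤ f.u x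

/-- An admissible obstacle. -/
structure Admissible (ψ : ℝ → ℝ) : Prop where
  cont : ContinuousOn ψ (Icc 0 1)
  neg0 : ψ 0 < 0
  neg1 : ψ 1 < 0
  pos : ∃ x ∈ Icc (0:ℝ) 1, 0 < ψ x
  osd : ∃ C : ℝ, ∀ x ∈ Ioo (0:ℝ) 1,
      (∃ d : ℝ, |d| ≤ C ∧ HasDerivWithinAt ψ d (Ici x) x) ∧
      (∃ d : ℝ, |d| ≤ C ∧ HasDerivWithinAt ψ d (Iic x) x)

/-- `‖ψ'‖_∞`, the smallest uniform bound for the one-sided derivatives of `ψ` on `(0,1)`. -/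
def obstNorm (ψ : ℝ → ℝ) : ℝ :=
  sInf {C : ℝ | 0 ≤ C ∧ ∀ x ∈ Ioo (0:ℝ) 1, ∀ d : ℝ,
    (HasDerivWithinAt ψ d (Ici x) x ∨ HasDerivWithinAt ψ d (Iic x) x) → |d| ≤ C}

/-- A planar curve on `(0,1)` of class `W^{1,1}((0,1);ℝ²)`. -/
structure Curve1 where
  x : ℝ → ℝ
  y : ℝ → ℝ
  dx : ℝ → ℝ
  dy : ℝ → ℝ
  dx_int : IntegrableOn dx (Icc (0:ℝ) 1)
  dy_int : IntegrableOn dy (Icc (0:ℝ) 1)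
  ftc_x : ∀ t ∈ Icc (0:ℝ) 1, x t = x 0 + ∫ s in (0:ℝ)..t, dx s
  ftc_y : ∀ t ∈ Icc (0:ℝ) 1, y t = y 0 + ∫ s in (0:ℝ)..t, dy s

/-- A planar curve of class `W^{1,1}((0,1);ℝ²) ∩ W^{2,1}_loc((0,1);ℝ²)`. -/
structure Curve extends Curve1 where
  ddx : ℝ → ℝ
  ddy : ℝ → ℝ
  ddx_loc : ∀ a b : ℝ, 0 < a → b < 1 → IntegrableOn ddx (Icc a b)
  ddy_loc : ∀ a b : ℝ, 0 < a → b < 1 → IntegrableOn ddy (Icc a b)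
  ftc_dx : ∀ a ∈ Ioo (0:ℝ) 1, ∀ t ∈ Ioo (0:ℝ) 1, dx t = dx a + ∫ s in a..t, ddx s
  ftc_dy : ∀ a ∈ Ioo (0:ℝ) 1, ∀ t ∈ Ioo (0:ℝ) 1, dy t = dy a + ∫ s in a..t, ddy s

/-- `|γ'(t)|`. -/
def speed1 (γ : Curve1) (t : ℝ) : ℝ := Real.sqrt ((γ.dx t)^2 + (γ.dy t)^2)

/-- The length `L(γ) = ∫₀¹ |γ'| dt`, as an extended real number. -/
def len1E (γ : Curve1) : ENNReal := ∫⁻ t in Ioo (0:ℝ) 1, ENNReal.ofReal (speed1 γ t)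

/-- The length `L(γ)`, as a real number. -/
def len1 (γ : Curve1) : ℝ := ∫ t in Ioo (0:ℝ) 1, speed1 γ t

def lenE (γ : Curve) : ENNReal := len1E γ.toCurve1

/-- The integrand `⟨γ'', N_γ⟩²/|γ'|³` of the elastic energy. -/
def elInt (γ : Curve) (t : ℝ) : ℝ :=
  (γ.dx t * γ.ddy t - γ.dy t * γ.ddx t)^2 / ((γ.dx t)^2 + (γ.dy t)^2) ^ ((5:ℝ)/2)

/-- Elastic energy of a curve, as an extended real number. -/
def elE (γ : Curve) : ENNReal := ∫⁻ t in Ioo (0:ℝ) 1, ENNReal.ofReal (elInt γ t)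

/-- The length-penalized elastic energy `E_ε = E + ε·L`. -/
def penE (ε : ℝ) (γ : Curve) : ENNReal := elE γ + ENNReal.ofReal ε * lenE γ

/-- A curve is immersed if `|γ'| > ε` on `(0,1)` for some `ε > 0`. -/
def Curve.Immersed (γ : Curve) : Prop :=
  ∃ ε > 0, ∀ t ∈ Ioo (0:ℝ) 1, ε < speed1 γ.toCurve1 t

/-- `u` lies in `W^{2,2}_loc(c,d)` with weak derivatives `du`, `ddu`. -/
structure W22locOn (u du ddu : ℝ → ℝ) (c d : ℝ) : Prop where
  du_loc : ∀ a b : ℝ, c < a → b < d → IntegrableOn du (Icc a b)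
  ddu_loc : ∀ a b : ℝ, c < a → b < d → IntegrableOn ddu (Icc a b)
  ddu_sq : ∀ a b : ℝ, c < a → b < d → IntegrableOn (fun t => (ddu t)^2) (Icc a b)
  ftc_u : ∀ a ∈ Ioo c d, ∀ t ∈ Ioo c d, u t = u a + ∫ s in a..t, du s
  ftc_du : ∀ a ∈ Ioo c d, ∀ t ∈ Ioo c d, du t = du a + ∫ s in a..t, ddu s

/-- `γ` is a pseudograph. -/
def Pseudograph (γ : Curve) : Prop :=
  γ.Immersed ∧ (∀ t ∈ Ioo (0:ℝ) 1, 0 ≤ γ.dx t) ∧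
  ∀ a b : ℝ, 0 ≤ a → a < b → b ≤ 1 → (∀ t ∈ Ioo a b, 0 < γ.dx t) →
    ∃ u du ddu : ℝ → ℝ, W22locOn u du ddu (γ.x a) (γ.x b) ∧
      ∀ t ∈ Ioo a b, u (γ.x t) = γ.y t

/-- Membership in `P_ψ`. -/
def MemP (ψ : ℝ → ℝ) (γ : Curve) : Prop :=
  Pseudograph γ ∧ γ.x 0 = 0 ∧ γ.y 0 = 0 ∧ γ.x 1 = 1 ∧ γ.y 1 = 0 ∧
  ∀ t ∈ Icc (0:ℝ) 1, ψ (γ.x t) ≤ γ.y t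

/-- `v : (a,b) → (c,d)` is invertible in `W^{1,1}` (increasing case): it has an
inverse `w` which is again of class `W^{1,1}`. -/
def InvertibleW11On (v : ℝ → ℝ) (a b c d : ℝ) : Prop :=
  ∃ w dw : ℝ → ℝ, IntegrableOn dw (Icc c d) ∧
    (∀ s ∈ Icc c d, w s = w c + ∫ r in c..s, dw r) ∧
    (∀ t ∈ Ioo a b, v t ∈ Ioo c d ∧ w (v t) = t) ∧
    (∀ s ∈ Ioo c d, w s ∈ Ioo a b ∧ v (w s) = s)

/-- `γ ∈ M_{γ₀}`: a `∩`-shaped curve above `γ₀` with parameters `β₁, β₂` and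
graph reparametrization `u`. -/
structure CapAbove (γ : Curve1) (γ₀ : Curve) (β₁ β₂ : ℝ) (u : ℝ → ℝ) : Prop where
  ep0 : γ.x 0 = 0 ∧ γ.y 0 = 0
  ep1 : γ.x 1 = 1 ∧ γ.y 1 = 0
  hβ : 0 ≤ β₁ ∧ β₁ < β₂ ∧ β₂ ≤ 1
  left : ∀ t ∈ Icc (0:ℝ) β₁, γ.x t = 0
  right : ∀ t ∈ Icc β₂ (1:ℝ), γ.x t = 1
  inv : InvertibleW11On γ.x β₁ β₂ 0 1
  graph : ∀ t ∈ Ioo β₁ β₂, u (γ.x t) = γ.y t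
  ucont : ContinuousOn u (Icc (0:ℝ) 1)
  above : ∀ t ∈ Icc (0:ℝ) 1, γ₀.y t ≤ u (γ₀.x t)

/-- A `∩`-shaped pseudograph with parameters `β₁, β₂` and graph reparametrization `u`
(with weak derivatives `du`, `ddu`). -/
structure CapShaped (γ : Curve) (β₁ β₂ : ℝ) (u du ddu : ℝ → ℝ) : Prop where
  hβ : 0 ≤ β₁ ∧ β₁ < β₂ ∧ β₂ ≤ 1
  left : ∀ t ∈ Icc (0:ℝ) β₁, γ.x t = 0
  right : ∀ t ∈ Icc β₂ (1:ℝ), γ.x t = 1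
  pos : ∀ t ∈ Ioo β₁ β₂, 0 < γ.dx t
  graph : ∀ t ∈ Ioo β₁ β₂, u (γ.x t) = γ.y t
  reg : W22locOn u du ddu 0 1

/-- `G(x) = ∫₀ˣ (1+s²)^{-5/4} ds`. -/
def Gfun (x : ℝ) : ℝ := ∫ s in (0:ℝ)..x, ((1 + s^2) ^ (-(5:ℝ)/4) : ℝ)

/-- `c₀ = ∫_ℝ (1+s²)^{-5/4} ds`. -/
def c0 : ℝ := ∫ s : ℝ, ((1 + s^2) ^ (-(5:ℝ)/4) : ℝ)

/-- The inverse of `G`. -/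
def Ginv : ℝ → ℝ := Function.invFun Gfun

/-- The ratio `R(B)` from the nonexistence theorem. -/
def ratio (B : ℝ) : ℝ :=
  (∫ t in (0:ℝ)..B, t / (Real.sqrt (B - t) * (1 + t^2) ^ ((5:ℝ)/4))) /
  (2 * ∫ t in (0:ℝ)..B, 1 / (Real.sqrt (B - t) * (1 + t^2) ^ ((5:ℝ)/4)))

/-- The symmetric cone obstacle with valley `[0,s]` and peak `A`. -/
def coneObstacle (A s : ℝ) : ℝ → ℝ := fun x =>
  if x ≤ 1/2 then A / (1/2 - s) * (x - s) else A / (1/2 - s) * (1 - s - x)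

/-- A primitive of an integrable function is continuous. -/
theorem continuousOn_of_eq_primitive {f df : ℝ → ℝ} {a b : ℝ} (hab : a ≤ b)
    (hdf : IntegrableOn df (Icc a b))
    (hf : ∀ t ∈ Icc a b, f t = f a + ∫ s in a..t, df s) : ContinuousOn f (Icc a b) := by
  have h := intervalIntegral.continuousOn_primitive_interval (μ := volume) (f := df)
    (a := a) (b := b) (by rwa [uIcc_of_le hab])
  rw [uIcc_of_le hab] at h
  exact (continuousOn_const.add h).congr hf

/-- A primitive is differentiable at every continuity point of the integrand. -/
theorem hasDerivAt_of_eq_primitive {f df : ℝ → ℝ} {a b t : ℝ}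
    (hdf : IntegrableOn df (Icc a b))
    (hf : ∀ t ∈ Icc a b, f t = f a + ∫ s in a..t, df s) (ht : t ∈ Ioo a b)
    (hc : ContinuousAt df t) : HasDerivAt f (df t) t := by
  have hnhds : Icc a b ∈ 𝓝 t := Icc_mem_nhds ht.1 ht.2
  have hdf' : IntervalIntegrable df volume a t := by
    rw [intervalIntegrable_iff_integrableOn_Ioc_of_le ht.1.le]
    exact hdf.mono_set (fun s hs => ⟨hs.1.le, hs.2.trans ht.2.le⟩)
  have h := intervalIntegral.integral_hasDerivAt_right hdf'
    ⟨Icc a b, hnhds, hdf.aestronglyMeasurable⟩ hc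
  refine (h.const_add (f a)).congr_of_eventuallyEq ?_
  filter_upwards [hnhds] with s hs using hf s hs

/-- A local primitive of a locally integrable function is continuous. -/
theorem continuousAt_of_eq_primitive_loc {f df : ℝ → ℝ} {c d t : ℝ}
    (hdf : ∀ a b : ℝ, c < a → b < d → IntegrableOn df (Icc a b))
    (hf : ∀ a ∈ Ioo c d, ∀ t ∈ Ioo c d, f t = f a + ∫ s in a..t, df s)
    (ht : t ∈ Ioo c d) : ContinuousAt f t := by
  obtain ⟨a, hca, hat⟩ := exists_between ht.1
  obtain ⟨b, htb, hbd⟩ := exists_between ht.2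
  exact (continuousOn_of_eq_primitive (hat.trans htb).le (hdf a b hca hbd)
    (fun s hs => hf a ⟨hca, hat.trans ht.2⟩ s ⟨hca.trans_le hs.1, hs.2.trans_lt hbd⟩)).continuousAt
    (Icc_mem_nhds hat htb)

namespace W22locOn

variable {u du ddu : ℝ → ℝ} {c d x : ℝ}

theorem hasDerivAt (h : W22locOn u du ddu c d) (hx : x ∈ Ioo c d) : HasDerivAt u (du x) x := by
  obtain ⟨a, hca, hat⟩ := exists_between hx.1
  obtain ⟨b, htb, hbd⟩ := exists_between hx.2
  exact hasDerivAt_of_eq_primitive (h.du_loc a b hca hbd)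
    (fun s hs => h.ftc_u a ⟨hca, hat.trans hx.2⟩ s ⟨hca.trans_le hs.1, hs.2.trans_lt hbd⟩)
    ⟨hat, htb⟩ (continuousAt_of_eq_primitive_loc h.ddu_loc h.ftc_du hx)

end W22locOn

namespace Curve

variable (γ : Curve) {t : ℝ}

theorem continuousAt_dx (ht : t ∈ Ioo (0:ℝ) 1) : ContinuousAt γ.dx t :=
  continuousAt_of_eq_primitive_loc γ.ddx_loc γ.ftc_dx ht

theorem continuousAt_dy (ht : t ∈ Ioo (0:ℝ) 1) : ContinuousAt γ.dy t :=
  continuousAt_of_eq_primitive_loc γ.ddy_loc γ.ftc_dy ht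

theorem hasDerivAt_x (ht : t ∈ Ioo (0:ℝ) 1) : HasDerivAt γ.x (γ.dx t) t :=
  hasDerivAt_of_eq_primitive γ.dx_int γ.ftc_x ht (γ.continuousAt_dx ht)

theorem hasDerivAt_y (ht : t ∈ Ioo (0:ℝ) 1) : HasDerivAt γ.y (γ.dy t) t :=
  hasDerivAt_of_eq_primitive γ.dy_int γ.ftc_y ht (γ.continuousAt_dy ht)

theorem continuousOn_x : ContinuousOn γ.x (Icc 0 1) :=
  continuousOn_of_eq_primitive zero_le_one γ.dx_int γ.ftc_x

theorem continuousOn_y : ContinuousOn γ.y (Icc 0 1) :=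
  continuousOn_of_eq_primitive zero_le_one γ.dy_int γ.ftc_y

/-- On an interval where an immersed curve is vertical, `γ₂'` does not vanish. -/
theorem Immersed.vertical {γ : Curve} (h : γ.Immersed) {a b k : ℝ} (hab : a < b)
    (hx : ∀ s ∈ Icc a b, γ.x s = k) (ht : t ∈ Ioo (0:ℝ) 1) (htab : t ∈ Icc a b) :
    γ.dx t = 0 ∧ γ.dy t ≠ 0 := by
  have h1 : HasDerivWithinAt γ.x (γ.dx t) (Icc a b) t := (γ.hasDerivAt_x ht).hasDerivWithinAt
  have h2 : HasDerivWithinAt γ.x 0 (Icc a b) t :=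
    (hasDerivWithinAt_const t (Icc a b) k).congr hx (hx t htab)
  have h0 : γ.dx t = 0 := (uniqueDiffOn_Icc hab t htab).eq_deriv _ h1 h2
  refine ⟨h0, fun hy => ?_⟩
  obtain ⟨ε, hε, hs⟩ := h
  have := hs t ht
  simp [speed1, h0, hy] at this
  linarith

/-- The length is at most the total variation of the two coordinates. -/
theorem lenE_le_of_unimodal (γ : Curve) (hdx : ∀ t ∈ Ioo (0:ℝ) 1, 0 ≤ γ.dx t) {T : ℝ}
    (hT : T ∈ Icc (0:ℝ) 1) (hpos : ∀ t ∈ Ioo 0 T, 0 ≤ γ.dy t)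
    (hneg : ∀ t ∈ Ioo T 1, γ.dy t ≤ 0) :
    lenE γ ≤ ENNReal.ofReal ((γ.x 1 - γ.x 0) + ((γ.y T - γ.y 0) + (γ.y T - γ.y 1))) := by
  have hiy : IntegrableOn (fun t => |γ.dy t|) (Icc 0 1) := γ.dy_int.abs
  have hi : IntegrableOn (fun t => γ.dx t + |γ.dy t|) (Ioo 0 1) :=
    (γ.dx_int.add hiy).mono_set Ioo_subset_Icc_self
  have hle : lenE γ ≤ ∫⁻ t in Ioo (0:ℝ) 1, ENNReal.ofReal (γ.dx t + |γ.dy t|) := by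
    refine setLIntegral_mono' measurableSet_Ioo fun t ht => ENNReal.ofReal_le_ofReal ?_
    have h0 := hdx t ht
    refine Real.sqrt_le_iff.2 ⟨by positivity, ?_⟩
    nlinarith [sq_abs (γ.dy t), mul_nonneg h0 (abs_nonneg (γ.dy t))]
  refine hle.trans ?_
  rw [← ofReal_integral_eq_lintegral_ofReal hi
    (ae_restrict_of_forall_mem measurableSet_Ioo fun t ht => add_nonneg (hdx t ht) (abs_nonneg _))]
  have ii : ∀ {f : ℝ → ℝ}, IntegrableOn f (Icc 0 1) → ∀ a ∈ Icc (0:ℝ) 1, ∀ b ∈ Icc (0:ℝ) 1,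
      IntervalIntegrable f volume a b := fun hf a ha b hb =>
    (hf.mono_set ((convex_Icc (0:ℝ) 1).ordConnected.uIcc_subset ha hb)).intervalIntegrable
  have m0 : (0:ℝ) ∈ Icc (0:ℝ) 1 := by simp
  have m1 : (1:ℝ) ∈ Icc (0:ℝ) 1 := by simp
  refine ENNReal.ofReal_le_ofReal (le_of_eq ?_)
  rw [← integral_Ioc_eq_integral_Ioo, ← intervalIntegral.integral_of_le zero_le_one,
    intervalIntegral.integral_add (ii γ.dx_int 0 m0 1 m1) (ii hiy 0 m0 1 m1),
    ← intervalIntegral.integral_add_adjacent_intervals (ii hiy 0 m0 T hT) (ii hiy T hT 1 m1)]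
  have e1 : ∫ t in (0:ℝ)..T, |γ.dy t| = ∫ t in (0:ℝ)..T, γ.dy t := by
    rw [intervalIntegral.integral_of_le hT.1, intervalIntegral.integral_of_le hT.1,
      integral_Ioc_eq_integral_Ioo, integral_Ioc_eq_integral_Ioo]
    exact setIntegral_congr_fun measurableSet_Ioo fun t ht => abs_of_nonneg (hpos t ht)
  have e2 : ∫ t in T..(1:ℝ), |γ.dy t| = - ∫ t in T..(1:ℝ), γ.dy t := by
    rw [intervalIntegral.integral_of_le hT.2, intervalIntegral.integral_of_le hT.2,
      integral_Ioc_eq_integral_Ioo, integral_Ioc_eq_integral_Ioo, ← integral_neg]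
    exact setIntegral_congr_fun measurableSet_Ioo fun t ht => abs_of_nonpos (hneg t ht)
  have e3 := intervalIntegral.integral_add_adjacent_intervals
    (ii γ.dy_int 0 m0 T hT) (ii γ.dy_int T hT 1 m1)
  rw [e1, e2]
  linarith [γ.ftc_x 1 m1, γ.ftc_y 1 m1, γ.ftc_y T hT]

end Curve

namespace CapShaped

variable {γ : Curve} {β₁ β₂ : ℝ} {u du ddu : ℝ → ℝ} {s t : ℝ}

theorem mem_Ioo (h : CapShaped γ β₁ β₂ u du ddu) (ht : t ∈ Ioo β₁ β₂) : t ∈ Ioo (0:ℝ) 1 :=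
  ⟨h.hβ.1.trans_lt ht.1, ht.2.trans_le h.hβ.2.2⟩

theorem x_mem (h : CapShaped γ β₁ β₂ u du ddu) (ht : t ∈ Ioo β₁ β₂) :
    γ.x t ∈ Ioo (0:ℝ) 1 := by
  obtain ⟨h0, h12, h1⟩ := h.hβ
  have hmono : StrictMonoOn γ.x (Icc β₁ β₂) := by
    refine strictMonoOn_of_deriv_pos (convex_Icc _ _)
      (γ.continuousOn_x.mono (Icc_subset_Icc h0 h1)) fun r hr => ?_
    rw [interior_Icc] at hr
    rw [(γ.hasDerivAt_x (h.mem_Ioo hr)).deriv]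
    exact h.pos r hr
  have ha := hmono (left_mem_Icc.2 h12.le) (Ioo_subset_Icc_self ht) ht.1
  have hb := hmono (Ioo_subset_Icc_self ht) (right_mem_Icc.2 h12.le) ht.2
  rw [h.left β₁ ⟨h0, le_rfl⟩] at ha
  rw [h.right β₂ ⟨le_rfl, h1⟩] at hb
  exact ⟨ha, hb⟩

theorem exists_x_eq (h : CapShaped γ β₁ β₂ u du ddu) {x : ℝ} (hx : x ∈ Ioo (0:ℝ) 1) :
    ∃ t ∈ Ioo β₁ β₂, γ.x t = x := by
  obtain ⟨h0, h12, h1⟩ := h.hβ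
  have := intermediate_value_Ioo h12.le (γ.continuousOn_x.mono (Icc_subset_Icc h0 h1))
  rw [h.left β₁ ⟨h0, le_rfl⟩, h.right β₂ ⟨le_rfl, h1⟩] at this
  exact this hx

theorem dy_eq (h : CapShaped γ β₁ β₂ u du ddu) (ht : t ∈ Ioo β₁ β₂) :
    γ.dy t = du (γ.x t) * γ.dx t := by
  have h1 := (h.reg.hasDerivAt (h.x_mem ht)).comp t (γ.hasDerivAt_x (h.mem_Ioo ht))
  refine (γ.hasDerivAt_y (h.mem_Ioo ht)).unique (h1.congr_of_eventuallyEq ?_)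
  filter_upwards [Ioo_mem_nhds ht.1 ht.2] with r hr using (h.graph r hr).symm

theorem x_le (h : CapShaped γ β₁ β₂ u du ddu) (hdx : ∀ t ∈ Ioo (0:ℝ) 1, 0 ≤ γ.dx t)
    (hs : s ∈ Ioo β₁ β₂) (ht : t ∈ Ioo β₁ β₂) (hst : s ≤ t) : γ.x s ≤ γ.x t := by
  refine monotoneOn_of_deriv_nonneg (convex_Icc 0 1) γ.continuousOn_x ?_ ?_
    (Ioo_subset_Icc_self (h.mem_Ioo hs)) (Ioo_subset_Icc_self (h.mem_Ioo ht)) hst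
  · intro r hr
    rw [interior_Icc] at hr
    exact (γ.hasDerivAt_x hr).differentiableAt.differentiableWithinAt
  · intro r hr
    rw [interior_Icc] at hr
    rw [(γ.hasDerivAt_x hr).deriv]
    exact hdx r hr

/-- The tangent direction of a curve that is concave on the top turns clockwise. -/
theorem cross_nonpos (h : CapShaped γ β₁ β₂ u du ddu) (hdx : ∀ t ∈ Ioo (0:ℝ) 1, 0 ≤ γ.dx t)
    (hconc : ConcaveOn ℝ (Ioo (0:ℝ) 1) u) (hs : s ∈ Ioo β₁ β₂) (ht : t ∈ Ioo β₁ β₂)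
    (hst : s ≤ t) : γ.dy t * γ.dx s ≤ γ.dy s * γ.dx t := by
  have hanti := hconc.antitoneOn_deriv
    (fun r hr => (h.reg.hasDerivAt hr).differentiableAt)
    (h.x_mem hs) (h.x_mem ht) (h.x_le hdx hs ht hst)
  rw [(h.reg.hasDerivAt (h.x_mem hs)).deriv, (h.reg.hasDerivAt (h.x_mem ht)).deriv] at hanti
  rw [h.dy_eq hs, h.dy_eq ht]
  nlinarith [mul_pos (h.pos s hs) (h.pos t ht)]

/-- The initial vertical part of a curve that is concave on the top points upwards. -/
theorem dy_pos_left (h : CapShaped γ β₁ β₂ u du ddu) (himm : γ.Immersed)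
    (hdx : ∀ t ∈ Ioo (0:ℝ) 1, 0 ≤ γ.dx t) (hconc : ConcaveOn ℝ (Ioo (0:ℝ) 1) u)
    (ht : t ∈ Ioc 0 β₁) : 0 < γ.dy t := by
  obtain ⟨h0, h12, h1⟩ := h.hβ
  have hβ0 : 0 < β₁ := ht.1.trans_le ht.2
  have hsub : ∀ r ∈ Ioc 0 β₁, r ∈ Ioo (0:ℝ) 1 := fun r hr => ⟨hr.1, by linarith [hr.2]⟩
  have hvert : ∀ r ∈ Ioc 0 β₁, γ.dx r = 0 ∧ γ.dy r ≠ 0 := fun r hr =>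
    himm.vertical hβ0 h.left (hsub r hr) ⟨hr.1.le, hr.2⟩
  have mβ : β₁ ∈ Ioc 0 β₁ := ⟨hβ0, le_rfl⟩
  obtain ⟨r, hr⟩ := exists_between h12
  have hlim : γ.dy r * γ.dx β₁ ≤ γ.dy β₁ * γ.dx r := by
    refine le_of_tendsto_of_tendsto (b := 𝓝[>] β₁) (f := fun s => γ.dy r * γ.dx s)
      (g := fun s => γ.dy s * γ.dx r)
      (((γ.continuousAt_dx (hsub _ mβ)).tendsto.mono_left nhdsWithin_le_nhds).const_mul _)
      (((γ.continuousAt_dy (hsub _ mβ)).tendsto.mono_left nhdsWithin_le_nhds).mul_const _) ?_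
    filter_upwards [Ioo_mem_nhdsGT hr.1] with s hs
    exact h.cross_nonpos hdx hconc ⟨hs.1, hs.2.trans hr.2⟩ hr hs.2.le
  rw [(hvert _ mβ).1, mul_zero] at hlim
  have hβpos : 0 < γ.dy β₁ :=
    lt_of_le_of_ne (nonneg_of_mul_nonneg_left hlim (h.pos r hr)) (hvert _ mβ).2.symm
  by_contra hneg
  obtain ⟨z, hz, hz0⟩ := intermediate_value_Icc ht.2
    (f := γ.dy) (fun z hz => (γ.continuousAt_dy
      (hsub z ⟨ht.1.trans_le hz.1, hz.2⟩)).continuousWithinAt) ⟨not_lt.1 hneg, hβpos.le⟩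
  exact (hvert z ⟨ht.1.trans_le hz.1, hz.2⟩).2 hz0

/-- The final vertical part of a curve that is concave on the top points downwards. -/
theorem dy_neg_right (h : CapShaped γ β₁ β₂ u du ddu) (himm : γ.Immersed)
    (hdx : ∀ t ∈ Ioo (0:ℝ) 1, 0 ≤ γ.dx t) (hconc : ConcaveOn ℝ (Ioo (0:ℝ) 1) u)
    (ht : t ∈ Ico β₂ 1) : γ.dy t < 0 := by
  obtain ⟨h0, h12, h1⟩ := h.hβ
  have hβ1 : β₂ < 1 := ht.1.trans_lt ht.2
  have hsub : ∀ r ∈ Ico β₂ 1, r ∈ Ioo (0:ℝ) 1 := fun r hr => ⟨by linarith [hr.1], hr.2⟩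
  have hvert : ∀ r ∈ Ico β₂ 1, γ.dx r = 0 ∧ γ.dy r ≠ 0 := fun r hr =>
    himm.vertical hβ1 h.right (hsub r hr) ⟨hr.1, hr.2.le⟩
  have mβ : β₂ ∈ Ico β₂ 1 := ⟨le_rfl, hβ1⟩
  obtain ⟨r, hr⟩ := exists_between h12
  have hlim : γ.dy β₂ * γ.dx r ≤ γ.dy r * γ.dx β₂ := by
    refine le_of_tendsto_of_tendsto (b := 𝓝[<] β₂) (f := fun s => γ.dy s * γ.dx r)
      (g := fun s => γ.dy r * γ.dx s)
      (((γ.continuousAt_dy (hsub _ mβ)).tendsto.mono_left nhdsWithin_le_nhds).mul_const _)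
      (((γ.continuousAt_dx (hsub _ mβ)).tendsto.mono_left nhdsWithin_le_nhds).const_mul _) ?_
    filter_upwards [Ioo_mem_nhdsLT hr.2] with s hs
    exact h.cross_nonpos hdx hconc hr ⟨hr.1.trans hs.1, hs.2⟩ hs.1.le
  rw [(hvert _ mβ).1, mul_zero] at hlim
  have hβneg : γ.dy β₂ < 0 :=
    lt_of_le_of_ne (nonpos_of_mul_nonpos_left hlim (h.pos r hr)) (hvert _ mβ).2
  by_contra hpos
  obtain ⟨z, hz, hz0⟩ := intermediate_value_Icc ht.1
    (f := γ.dy) (fun z hz => (γ.continuousAt_dy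
      (hsub z ⟨hz.1, hz.2.trans_lt ht.2⟩)).continuousWithinAt) ⟨hβneg.le, not_lt.1 hpos⟩
  exact (hvert z ⟨hz.1, hz.2.trans_lt ht.2⟩).2 hz0

/-- The height of a curve that is concave on the top first increases and then decreases. -/
theorem exists_peak (h : CapShaped γ β₁ β₂ u du ddu) (himm : γ.Immersed)
    (hdx : ∀ t ∈ Ioo (0:ℝ) 1, 0 ≤ γ.dx t) (hconc : ConcaveOn ℝ (Ioo (0:ℝ) 1) u) :
    ∃ T ∈ Icc β₁ β₂, (∀ t ∈ Ioo 0 T, 0 ≤ γ.dy t) ∧ ∀ t ∈ Ioo T 1, γ.dy t ≤ 0 := by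
  have h12 := h.hβ.2.1
  set A : Set ℝ := insert β₁ {t ∈ Ioo β₁ β₂ | 0 < γ.dy t} with hA
  have hub : ∀ t ∈ A, t ≤ β₂ := by
    rintro t (rfl | ht)
    exacts [h12.le, ht.1.2.le]
  have hbdd : BddAbove A := ⟨β₂, hub⟩
  have hne : A.Nonempty := ⟨β₁, mem_insert _ _⟩
  refine ⟨sSup A, ⟨le_csSup hbdd (mem_insert _ _), csSup_le hne hub⟩, ?_, ?_⟩
  · intro t ht
    rcases le_or_gt t β₁ with hle | hgt
    · exact (h.dy_pos_left himm hdx hconc ⟨ht.1, hle⟩).le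
    · obtain ⟨r, hr, htr⟩ := exists_lt_of_lt_csSup hne ht.2
      rcases hr with rfl | hr
      · exact absurd hgt htr.not_gt
      · have ht' : t ∈ Ioo β₁ β₂ := ⟨hgt, htr.trans hr.1.2⟩
        have := h.cross_nonpos hdx hconc ht' hr.1 htr.le
        refine nonneg_of_mul_nonneg_left (this.trans' ?_) (h.pos r hr.1)
        exact mul_nonneg hr.2.le (h.pos t ht').le
  · intro t ht
    have hgt : β₁ < t := (le_csSup hbdd (mem_insert _ _)).trans_lt ht.1
    rcases le_or_gt β₂ t with hle | hlt
    · exact (h.dy_neg_right himm hdx hconc ⟨hle, ht.2⟩).le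
    · by_contra hpos
      exact (le_csSup hbdd (mem_insert_of_mem _ ⟨⟨hgt, hlt⟩, not_le.1 hpos⟩)).not_gt ht.1

end CapShaped

/-- The one-sided derivatives of an admissible obstacle are bounded by `obstNorm`. -/
theorem Admissible.abs_le_obstNorm {ψ : ℝ → ℝ} (hψ : Admissible ψ) {x d : ℝ}
    (hx : x ∈ Ioo (0:ℝ) 1)
    (hd : HasDerivWithinAt ψ d (Ici x) x ∨ HasDerivWithinAt ψ d (Iic x) x) :
    |d| ≤ obstNorm ψ := by
  refine le_csInf ?_ fun C hC => hC.2 x hx d hd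
  obtain ⟨C, hC⟩ := hψ.osd
  obtain ⟨⟨d₀, hd₀, -⟩, -⟩ := hC x hx
  refine ⟨C, (abs_nonneg d₀).trans hd₀, fun z hz e he => ?_⟩
  obtain ⟨⟨d₁, hd₁, h₁⟩, ⟨d₂, hd₂, h₂⟩⟩ := hC z hz
  rcases he with he | he
  · rwa [(uniqueDiffOn_Ici z z self_mem_Ici).eq_deriv _ he h₁]
  · rwa [(uniqueDiffOn_Iic z z self_mem_Iic).eq_deriv _ he h₂]

/-- The slope of a function touching an admissible obstacle from above is bounded by
`obstNorm` at the touching point. -/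
theorem Admissible.abs_slope_le {ψ u : ℝ → ℝ} (hψ : Admissible ψ) {x m : ℝ}
    (hx : x ∈ Ioo (0:ℝ) 1) (hu : HasDerivAt u m x) (hle : ∀ z ∈ Ioo (0:ℝ) 1, ψ z ≤ u z)
    (heq : u x = ψ x) : |m| ≤ obstNorm ψ := by
  obtain ⟨C, hC⟩ := hψ.osd
  obtain ⟨⟨d₁, -, h₁⟩, ⟨d₂, -, h₂⟩⟩ := hC x hx
  have b₁ := hψ.abs_le_obstNorm hx (.inl h₁)
  have b₂ := hψ.abs_le_obstNorm hx (.inr h₂)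
  have k₁ : d₁ ≤ m := by
    have s₁ := h₁.mono (Ioi_subset_Ici_self)
    rw [hasDerivWithinAt_iff_tendsto_slope' self_notMem_Ioi] at s₁
    have s₂ := hu.hasDerivWithinAt (s := Ioi x)
    rw [hasDerivWithinAt_iff_tendsto_slope' self_notMem_Ioi] at s₂
    refine le_of_tendsto_of_tendsto s₁ s₂ ?_
    filter_upwards [Ioo_mem_nhdsGT hx.2] with z hz
    rw [slope_def_field, slope_def_field, heq]
    have := hle z ⟨hx.1.trans hz.1, hz.2⟩
    exact div_le_div_of_nonneg_right (by linarith) (by linarith [hz.1])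
  have k₂ : m ≤ d₂ := by
    have s₁ := h₂.mono (Iio_subset_Iic_self)
    rw [hasDerivWithinAt_iff_tendsto_slope' self_notMem_Iio] at s₁
    have s₂ := hu.hasDerivWithinAt (s := Iio x)
    rw [hasDerivWithinAt_iff_tendsto_slope' self_notMem_Iio] at s₂
    refine le_of_tendsto_of_tendsto s₂ s₁ ?_
    filter_upwards [Ioo_mem_nhdsLT hx.1] with z hz
    rw [slope_def_field, slope_def_field, heq]
    have := hle z ⟨hz.1, hz.2.trans hx.2⟩
    exact div_le_div_of_nonpos_of_le (by linarith [hz.2]) (by linarith)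
  rw [abs_le] at *
  constructor <;> linarith [b₁.1, b₂.2]

/-- A concave function lies below its tangent lines. -/
theorem ConcaveOn.le_tangent {s : Set ℝ} {u : ℝ → ℝ} (h : ConcaveOn ℝ s u) {x z m : ℝ}
    (hx : x ∈ s) (hz : z ∈ s) (hu : HasDerivAt u m x) : u z ≤ u x + m * (z - x) := by
  rcases lt_trichotomy x z with hlt | rfl | hlt
  · have := h.slope_le_of_hasDerivAt hx hz hlt hu
    rw [slope_def_field, div_le_iff₀ (by linarith)] at this
    linarith
  · simp
  · have := h.le_slope_of_hasDerivAt hz hx hlt hu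
    rw [slope_def_field, le_div_iff₀ (by linarith)] at this
    linarith

/-- A length bound for `∩`-shaped pseudographs touching the obstacle. -/
theorem stmt17 (ψ : ℝ → ℝ) (hψ : Admissible ψ) (γ : Curve) (β₁ β₂ : ℝ)
    (u du ddu : ℝ → ℝ) (hP : MemP ψ γ) (hcap : CapShaped γ β₁ β₂ u du ddu)
    (hconc : ConcaveOn ℝ (Ioo (0:ℝ) 1) u)
    (htouch : ∃ x₀ ∈ Ioo (0:ℝ) 1, u x₀ = ψ x₀) :
    lenE γ ≤ ENNReal.ofReal (2 * (sSup (ψ '' Ioo 0 1) + obstNorm ψ) + 1) := by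
  obtain ⟨⟨himm, hdx, -⟩, hx0, hy0, hx1, hy1, hobst⟩ := hP
  obtain ⟨x₀, hx₀, heq⟩ := htouch
  obtain ⟨h0, h12, h1⟩ := hcap.hβ
  have hle : ∀ z ∈ Ioo (0:ℝ) 1, ψ z ≤ u z := by
    intro z hz
    obtain ⟨t, ht, rfl⟩ := hcap.exists_x_eq hz
    rw [hcap.graph t ht]
    exact hobst t (Ioo_subset_Icc_self (hcap.mem_Ioo ht))
  have hderiv := hcap.reg.hasDerivAt hx₀
  have hslope := hψ.abs_slope_le hx₀ hderiv hle heq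
  have hsup : ψ x₀ ≤ sSup (ψ '' Ioo 0 1) :=
    le_csSup ((isCompact_Icc.bddAbove_image hψ.cont).mono (image_mono Ioo_subset_Icc_self))
      (mem_image_of_mem ψ hx₀)
  have hbound : ∀ t ∈ Ioo β₁ β₂, γ.y t ≤ sSup (ψ '' Ioo 0 1) + obstNorm ψ := by
    intro t ht
    have hz := hcap.x_mem ht
    have htan := hconc.le_tangent hx₀ hz hderiv
    rw [hcap.graph t ht, heq] at htan
    have hdist : |γ.x t - x₀| ≤ 1 := abs_le.2 ⟨by linarith [hz.1, hx₀.2], by linarith [hz.2, hx₀.1]⟩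
    have hmul : du x₀ * (γ.x t - x₀) ≤ |du x₀| := (le_abs_self _).trans <| by
      rw [abs_mul]
      exact mul_le_of_le_one_right (abs_nonneg _) hdist
    linarith
  obtain ⟨T, hT, hpos, hneg⟩ := hcap.exists_peak himm hdx hconc
  have hyT : γ.y T ≤ sSup (ψ '' Ioo 0 1) + obstNorm ψ := by
    rw [← closure_Ioo h12.ne] at hT
    refine le_on_closure hbound ?_ continuousOn_const hT
    rw [closure_Ioo h12.ne]
    exact γ.continuousOn_y.mono (Icc_subset_Icc h0 h1)
  refine (γ.lenE_le_of_unimodal hdx ⟨h0.trans hT.1, hT.2.trans h1⟩ hpos hneg).trans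
    (ENNReal.ofReal_le_ofReal ?_)
  rw [hx0, hx1, hy0, hy1]
  linarith
end
end

section
/- Let c₀ = ∫_{-∞}^{∞} (1+s²)^{-5/4} ds, let G(x) = ∫₀ˣ (1+s²)^{-5/4} ds with inverse G^{-1} : (−c₀/2, c₀/2) → ℝ, and define U₀(x) = (2/c₀)·(1 + G^{-1}(c₀/2 − c₀x)²)^{-1/4} for x ∈ (0,1), U₀(0) = U₀(1) = 0. Then on (0,1) one has U₀'(x) = G^{-1}(c₀/2 − c₀x) and U₀''(x) = −c₀·(1 + G^{-1}(c₀/2 − c₀x)²)^{5/4}; consequently ∫₀¹ U₀''(x)²/(1+U₀'(x)²)^{5/2} dx = c₀² and ∫₀¹ √(1+U₀'(x)²) dx = (1/c₀)·∫_{-∞}^{∞} (1+t²)^{-3/4} dt. In particular, for an admissible obstacle ψ with S := sup_{x∈(0,1)} ψ(x), the curve γ obtained by concatenating the vertical segment from (0,0) to (0,S), the graph of S + U₀ over [0,1], and the vertical segment from (1,S) to (1,0) lies in P_ψ (after weak reparametrization), has elastic energy E(γ) = c₀², and has length L(γ) = 2S + (1/c₀)·∫_{-∞}^{∞} (1+t²)^{-3/4}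 dt. -/
open MeasureTheory Set Topology Filter

noncomputable section

/-- The comparison function `U₀`. -/
def U0fun (x : ℝ) : ℝ :=
  if x = 0 ∨ x = 1 then 0
  else (2 / c0) * (1 + (Ginv (c0/2 - c0*x))^2) ^ (-(1:ℝ)/4)

/-- `U₀'`. -/
def DU0 (x : ℝ) : ℝ := Ginv (c0/2 - c0*x)

/-- `U₀''`. -/
def DDU0 (x : ℝ) : ℝ := -c0 * (1 + (Ginv (c0/2 - c0*x))^2) ^ ((5:ℝ)/4)

/-- `√(1 + sin² φ)`, the reciprocal of the normalized speed of the rectangular elastica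
parametrized by `φ`. -/
def elasticaRoot (φ : ℝ) : ℝ := √(1 + Real.sin φ ^ 2)

/-- The normalized horizontal velocity of the rectangular elastica. -/
def elasticaVel (φ : ℝ) : ℝ := Real.sin φ ^ 2 / elasticaRoot φ

/-- The derivative of `elasticaVel`. -/
def elasticaAcc (φ : ℝ) : ℝ :=
  Real.sin φ * Real.cos φ * (2 + Real.sin φ ^ 2) / elasticaRoot φ ^ 3

/-- The slope of the rectangular elastica. -/
def elasticaSlope (φ : ℝ) : ℝ := Real.cos φ * elasticaRoot φ / Real.sin φ ^ 2

/-- The abscissa of the rectangular elastica of unit width. -/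
def elasticaX (φ : ℝ) : ℝ := 2 / c0 * ∫ s in (0:ℝ)..φ, elasticaVel s

theorem elasticaRoot_pos (φ : ℝ) : 0 < elasticaRoot φ :=
  Real.sqrt_pos.2 (by positivity)

theorem elasticaRoot_sq (φ : ℝ) : elasticaRoot φ ^ 2 = 1 + Real.sin φ ^ 2 :=
  Real.sq_sqrt (by positivity)

theorem elasticaRoot_lt_two (φ : ℝ) : elasticaRoot φ < 2 := by
  nlinarith [elasticaRoot_sq φ, elasticaRoot_pos φ, Real.sin_sq_le_one φ]

theorem continuous_elasticaRoot : Continuous elasticaRoot := by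
  unfold elasticaRoot; fun_prop

theorem continuous_elasticaVel : Continuous elasticaVel :=
  (Real.continuous_sin.pow 2).div continuous_elasticaRoot fun φ => (elasticaRoot_pos φ).ne'

theorem continuous_elasticaAcc : Continuous elasticaAcc :=
  Continuous.div (by fun_prop) (continuous_elasticaRoot.pow 3)
    fun φ => (pow_pos (elasticaRoot_pos φ) 3).ne'

theorem hasDerivAt_elasticaRoot (φ : ℝ) :
    HasDerivAt elasticaRoot (Real.sin φ * Real.cos φ / elasticaRoot φ) φ := by
  have h := (((Real.hasDerivAt_sin φ).pow 2).const_add 1).sqrt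
    (by positivity : 1 + Real.sin φ ^ 2 ≠ 0)
  refine h.congr_deriv ?_
  have := elasticaRoot_pos φ
  rw [Pi.pow_apply, ← elasticaRoot]
  field_simp
  push_cast
  ring

theorem hasDerivAt_elasticaVel (φ : ℝ) : HasDerivAt elasticaVel (elasticaAcc φ) φ := by
  have h := ((Real.hasDerivAt_sin φ).pow 2).div (hasDerivAt_elasticaRoot φ)
    (elasticaRoot_pos φ).ne'
  refine h.congr_deriv ?_
  have := elasticaRoot_pos φ
  have hq := elasticaRoot_sq φ
  simp only [elasticaAcc, Pi.pow_apply]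
  field_simp
  rw [hq]
  push_cast
  ring

theorem elasticaVel_nonneg (φ : ℝ) : 0 ≤ elasticaVel φ :=
  div_nonneg (sq_nonneg _) (elasticaRoot_pos φ).le

theorem elasticaVel_pos {φ : ℝ} (hφ : φ ∈ Ioo 0 Real.pi) : 0 < elasticaVel φ :=
  div_pos (pow_pos (Real.sin_pos_of_mem_Ioo hφ) 2) (elasticaRoot_pos φ)

theorem elasticaVel_sq_add_cos_sq (φ : ℝ) :
    elasticaVel φ ^ 2 + Real.cos φ ^ 2 = (1 / elasticaRoot φ) ^ 2 := by
  have := elasticaRoot_pos φ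
  have hq := elasticaRoot_sq φ
  rw [elasticaVel, Real.cos_sq']
  field_simp
  rw [hq]
  ring

theorem elasticaVel_cross (φ : ℝ) :
    elasticaVel φ * -Real.sin φ - Real.cos φ * elasticaAcc φ
      = -(2 * Real.sin φ / elasticaRoot φ ^ 3) := by
  have := elasticaRoot_pos φ
  have hq := elasticaRoot_sq φ
  have hc := Real.cos_sq' φ
  rw [elasticaVel, elasticaAcc]
  field_simp
  rw [hq, hc]
  ring

section Slope

variable {φ : ℝ} (hφ : φ ∈ Ioo 0 Real.pi)
include hφ

theorem one_add_elasticaSlope_sq : 1 + elasticaSlope φ ^ 2 = Real.sin φ ^ (-4 : ℝ) := by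
  have hs := Real.sin_pos_of_mem_Ioo hφ
  rw [show (-4 : ℝ) = -((4 : ℕ) : ℝ) by norm_num, Real.rpow_neg hs.le, Real.rpow_natCast,
    elasticaSlope, div_pow, mul_pow, elasticaRoot_sq, Real.cos_sq']
  field_simp
  ring

theorem one_add_elasticaSlope_sq_rpow (r : ℝ) :
    (1 + elasticaSlope φ ^ 2) ^ r = Real.sin φ ^ (-4 * r) := by
  rw [one_add_elasticaSlope_sq hφ, ← Real.rpow_mul (Real.sin_pos_of_mem_Ioo hφ).le]

theorem hasDerivAt_elasticaSlope :
    HasDerivAt elasticaSlope (-(2 / (Real.sin φ ^ 3 * elasticaRoot φ))) φ := by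
  have hs := Real.sin_pos_of_mem_Ioo hφ
  have h := ((Real.hasDerivAt_cos φ).mul (hasDerivAt_elasticaRoot φ)).div
    ((Real.hasDerivAt_sin φ).pow 2) (pow_pos hs 2).ne'
  refine h.congr_deriv ?_
  have := elasticaRoot_pos φ
  have hq := elasticaRoot_sq φ
  have hc := Real.cos_sq' φ
  simp only [Pi.pow_apply, Pi.mul_apply]
  field_simp
  push_cast
  rw [hq]
  ring_nf
  rw [hc]
  ring

end Slope

theorem injOn_elasticaSlope : InjOn elasticaSlope (Ioo 0 Real.pi) := by
  refine StrictAntiOn.injOn (strictAntiOn_of_deriv_neg (convex_Ioo _ _)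
    (fun φ hφ => (hasDerivAt_elasticaSlope hφ).continuousAt.continuousWithinAt) fun φ hφ => ?_)
  rw [interior_Ioo] at hφ
  rw [(hasDerivAt_elasticaSlope hφ).deriv, neg_lt_zero]
  have := Real.sin_pos_of_mem_Ioo hφ
  have := elasticaRoot_pos φ
  positivity

theorem exists_elasticaSlope_eq (t : ℝ) : ∃ φ ∈ Ioo 0 Real.pi, elasticaSlope φ = t := by
  obtain ⟨r, hr⟩ : ∃ r, r = √(1 + t ^ 2) := ⟨_, rfl⟩
  have hr0 : 0 < r := hr ▸ Real.sqrt_pos.2 (by positivity)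
  have hr2 : r ^ 2 = 1 + t ^ 2 := hr ▸ Real.sq_sqrt (by positivity)
  obtain ⟨c, hc⟩ : ∃ c, c = t / √(r * (r + 1)) := ⟨_, rfl⟩
  have hc2 : c ^ 2 = 1 - 1 / r := by
    rw [hc, div_pow, Real.sq_sqrt (by positivity)]
    field_simp
    linarith
  have hlt : c ^ 2 < 1 := by rw [hc2]; have : 0 < 1 / r := by positivity
                             linarith
  obtain ⟨h1, h2⟩ := abs_lt.1 ((sq_lt_one_iff_abs_lt_one c).1 hlt)
  refine ⟨Real.arccos c, ⟨Real.arccos_pos.2 h2, ?_⟩, ?_⟩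
  · refine (Real.arccos_le_pi c).lt_of_ne fun h => ?_
    rw [Real.arccos_eq_pi] at h
    linarith
  have hsin : Real.sin (Real.arccos c) ^ 2 = 1 / r := by
    rw [Real.sin_sq, Real.cos_arccos h1.le h2.le, hc2]; ring
  rw [elasticaSlope, elasticaRoot, hsin, Real.cos_arccos h1.le h2.le, hc,
    show 1 + 1 / r = r * (r + 1) / r ^ 2 by field_simp, Real.sqrt_div (by positivity),
    Real.sqrt_sq hr0.le]
  field_simp

theorem image_elasticaSlope : elasticaSlope '' Ioo 0 Real.pi = univ :=
  eq_univ_of_forall fun t => exists_elasticaSlope_eq t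

/-- The change of variables `t = elasticaSlope φ`. -/
theorem integral_one_add_sq_rpow (r : ℝ) :
    ∫ t : ℝ, (1 + t ^ 2) ^ r
      = ∫ φ in Ioo 0 Real.pi, 2 * Real.sin φ ^ (-4 * r - 3) / elasticaRoot φ := by
  rw [← setIntegral_univ, ← image_elasticaSlope,
    integral_image_eq_integral_abs_deriv_smul measurableSet_Ioo
      (fun φ hφ => (hasDerivAt_elasticaSlope hφ).hasDerivWithinAt) injOn_elasticaSlope]
  refine setIntegral_congr_fun measurableSet_Ioo fun φ hφ => ?_
  have hs := Real.sin_pos_of_mem_Ioo hφ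
  have := elasticaRoot_pos φ
  simp only [smul_eq_mul]
  rw [one_add_elasticaSlope_sq_rpow hφ, abs_neg, abs_of_nonneg (by positivity),
    show Real.sin φ ^ (-4 * r - 3) = Real.sin φ ^ (-4 * r) / Real.sin φ ^ 3 by
      rw [Real.rpow_sub hs]; norm_cast]
  field_simp

theorem c0_eq : c0 = 2 * ∫ φ in (0:ℝ)..Real.pi, elasticaVel φ := by
  rw [c0, integral_one_add_sq_rpow, intervalIntegral.integral_of_le Real.pi_pos.le,
    integral_Ioc_eq_integral_Ioo, ← integral_const_mul]
  refine setIntegral_congr_fun measurableSet_Ioo fun φ _ => ?_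
  simp only [elasticaVel]
  rw [show -4 * (-(5:ℝ) / 4) - 3 = ((2 : ℕ) : ℝ) by norm_num, Real.rpow_natCast]
  ring

theorem integral_one_add_sq_rpow_neg_three_quarters :
    ∫ t : ℝ, (1 + t ^ 2) ^ (-(3:ℝ)/4)
      = 2 * ∫ φ in (0:ℝ)..Real.pi, 1 / elasticaRoot φ := by
  rw [integral_one_add_sq_rpow, intervalIntegral.integral_of_le Real.pi_pos.le,
    integral_Ioc_eq_integral_Ioo, ← integral_const_mul]
  refine setIntegral_congr_fun measurableSet_Ioo fun φ _ => ?_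
  rw [show -4 * (-(3:ℝ) / 4) - 3 = 0 by norm_num, Real.rpow_zero]
  ring

theorem c0_pos : 0 < c0 := by
  rw [c0_eq]
  refine mul_pos two_pos (intervalIntegral.intervalIntegral_pos_of_pos_on
    (continuous_elasticaVel.intervalIntegrable _ _) (fun φ hφ => elasticaVel_pos hφ) Real.pi_pos)

theorem hasDerivAt_elasticaX (φ : ℝ) : HasDerivAt elasticaX (2 / c0 * elasticaVel φ) φ :=
  (intervalIntegral.integral_hasDerivAt_right (continuous_elasticaVel.intervalIntegrable _ _)
    continuous_elasticaVel.stronglyMeasurable.stronglyMeasurableAtFilter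
    continuous_elasticaVel.continuousAt).const_mul _

theorem elasticaX_zero : elasticaX 0 = 0 := by simp [elasticaX]

theorem elasticaX_pi : elasticaX Real.pi = 1 := by
  have h := c0_eq
  have := c0_pos
  rw [elasticaX]
  field_simp
  linarith

theorem elasticaX_pi_div_two : elasticaX (Real.pi / 2) = 1 / 2 := by
  have hsymm : ∫ s in Real.pi / 2..Real.pi, elasticaVel s
      = ∫ s in (0:ℝ)..Real.pi / 2, elasticaVel s := by
    have h := intervalIntegral.integral_comp_sub_left (a := 0) (b := Real.pi / 2)
      elasticaVel Real.pi
    rw [sub_zero, sub_half] at h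
    rw [← h]
    simp [elasticaVel, elasticaRoot, Real.sin_pi_sub]
  have hadd := intervalIntegral.integral_add_adjacent_intervals
    (continuous_elasticaVel.intervalIntegrable (μ := volume) 0 (Real.pi / 2))
    (continuous_elasticaVel.intervalIntegrable (Real.pi / 2) Real.pi)
  have h := elasticaX_pi
  rw [elasticaX, ← hadd, hsymm] at h
  rw [elasticaX]
  linarith

theorem strictMonoOn_elasticaX : StrictMonoOn elasticaX (Icc 0 Real.pi) := by
  refine strictMonoOn_of_deriv_pos (convex_Icc _ _)
    (fun φ _ => (hasDerivAt_elasticaX φ).continuousAt.continuousWithinAt) fun φ hφ => ?_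
  rw [interior_Icc] at hφ
  rw [(hasDerivAt_elasticaX φ).deriv]
  exact mul_pos (div_pos two_pos c0_pos) (elasticaVel_pos hφ)

theorem elasticaX_mem_Ioo {φ : ℝ} (hφ : φ ∈ Ioo 0 Real.pi) : elasticaX φ ∈ Ioo 0 1 := by
  rw [← elasticaX_zero, ← elasticaX_pi]
  have hpi := Real.pi_pos.le
  exact ⟨strictMonoOn_elasticaX ⟨le_rfl, hpi⟩ ⟨hφ.1.le, hφ.2.le⟩ hφ.1,
    strictMonoOn_elasticaX ⟨hφ.1.le, hφ.2.le⟩ ⟨hpi, le_rfl⟩ hφ.2⟩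

theorem image_elasticaX : elasticaX '' Ioo 0 Real.pi = Ioo 0 1 := by
  refine Subset.antisymm (image_subset_iff.2 fun φ hφ => elasticaX_mem_Ioo hφ) ?_
  have h := intermediate_value_Ioo Real.pi_pos.le (f := elasticaX)
    (fun φ _ => (hasDerivAt_elasticaX φ).continuousAt.continuousWithinAt)
  rwa [elasticaX_zero, elasticaX_pi] at h

theorem continuous_one_add_sq_rpow (r : ℝ) : Continuous fun s : ℝ => (1 + s ^ 2) ^ r :=
  Continuous.rpow_const (by fun_prop) fun s => Or.inl (by positivity)

theorem hasStrictDerivAt_Gfun (t : ℝ) :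
    HasStrictDerivAt Gfun ((1 + t ^ 2) ^ (-(5:ℝ)/4)) t := by
  have hc := continuous_one_add_sq_rpow (-(5:ℝ)/4)
  exact intervalIntegral.integral_hasStrictDerivAt_right (hc.intervalIntegrable _ _)
    hc.stronglyMeasurable.stronglyMeasurableAtFilter hc.continuousAt

theorem strictMono_Gfun : StrictMono Gfun := by
  refine strictMono_of_deriv_pos fun t => ?_
  rw [(hasStrictDerivAt_Gfun t).hasDerivAt.deriv]
  positivity

theorem Ginv_Gfun (t : ℝ) : Ginv (Gfun t) = t :=
  Function.leftInverse_invFun strictMono_Gfun.injective t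

theorem hasDerivAt_Ginv (t : ℝ) : HasDerivAt Ginv ((1 + t ^ 2) ^ ((5:ℝ)/4)) (Gfun t) := by
  have h := (hasStrictDerivAt_Gfun t).to_local_left_inverse (by positivity)
    (Eventually.of_forall Ginv_Gfun)
  refine h.hasDerivAt.congr_deriv ?_
  rw [← Real.rpow_neg (by positivity)]
  norm_num

theorem Gfun_elasticaSlope {φ : ℝ} (hφ : φ ∈ Ioo 0 Real.pi) :
    Gfun (elasticaSlope φ) = c0 / 2 - c0 * elasticaX φ := by
  have hc := c0_pos
  have hd : ∀ θ ∈ Ioo 0 Real.pi,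
      HasDerivAt (fun θ => Gfun (elasticaSlope θ) + c0 * elasticaX θ) 0 θ := fun θ hθ => by
    have hs := Real.sin_pos_of_mem_Ioo hθ
    have hq := elasticaRoot_pos θ
    have h := ((hasStrictDerivAt_Gfun (elasticaSlope θ)).hasDerivAt.comp θ
      (hasDerivAt_elasticaSlope hθ)).add ((hasDerivAt_elasticaX θ).const_mul c0)
    refine h.congr_deriv ?_
    rw [one_add_elasticaSlope_sq_rpow hθ,
      show -4 * (-(5:ℝ) / 4) = ((5 : ℕ) : ℝ) by norm_num, Real.rpow_natCast, elasticaVel]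
    field_simp
    ring
  have hmid : Real.pi / 2 ∈ Ioo 0 Real.pi := ⟨Real.pi_div_two_pos, half_lt_self Real.pi_pos⟩
  have h := (convex_Ioo 0 Real.pi).is_const_of_fderivWithin_eq_zero (𝕜 := ℝ)
    (f := fun θ => Gfun (elasticaSlope θ) + c0 * elasticaX θ)
    (fun θ hθ => (hd θ hθ).differentiableAt.differentiableWithinAt)
    (fun θ hθ => by
      rw [fderivWithin_of_isOpen isOpen_Ioo hθ]
      ext
      simp [(hd θ hθ).deriv]) hφ hmid
  have h0 : Gfun (elasticaSlope (Real.pi / 2)) = 0 := by simp [elasticaSlope, Gfun]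
  simp only [h0, elasticaX_pi_div_two] at h
  linarith

theorem DU0_elasticaX {φ : ℝ} (hφ : φ ∈ Ioo 0 Real.pi) :
    DU0 (elasticaX φ) = elasticaSlope φ := by
  rw [DU0, ← Gfun_elasticaSlope hφ, Ginv_Gfun]

theorem U0fun_of_mem_Ioo {x : ℝ} (hx : x ∈ Ioo (0:ℝ) 1) :
    U0fun x = 2 / c0 * (1 + DU0 x ^ 2) ^ (-(1:ℝ)/4) := by
  rw [U0fun, if_neg (by rintro (h | h) <;> simp [h] at hx), DU0]

theorem U0fun_elasticaX {φ : ℝ} (hφ : φ ∈ Ioo 0 Real.pi) :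
    U0fun (elasticaX φ) = 2 / c0 * Real.sin φ := by
  rw [U0fun_of_mem_Ioo (elasticaX_mem_Ioo hφ), DU0_elasticaX hφ,
    one_add_elasticaSlope_sq_rpow hφ]
  norm_num

theorem hasDerivAt_DU0 {x : ℝ} (hx : x ∈ Ioo (0:ℝ) 1) : HasDerivAt DU0 (DDU0 x) x := by
  obtain ⟨φ, hφ, rfl⟩ := image_elasticaX.symm ▸ hx
  have hlin : HasDerivAt (fun x => c0 / 2 - c0 * x) (-c0) (elasticaX φ) := by
    simpa using ((hasDerivAt_id (elasticaX φ)).const_mul c0).const_sub (c0 / 2)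
  have hG := hasDerivAt_Ginv (elasticaSlope φ)
  rw [Gfun_elasticaSlope hφ] at hG
  have h := hG.comp (elasticaX φ) hlin
  refine h.congr_deriv ?_
  rw [DDU0, ← Gfun_elasticaSlope hφ, Ginv_Gfun, mul_comm]

theorem hasDerivAt_U0fun {x : ℝ} (hx : x ∈ Ioo (0:ℝ) 1) : HasDerivAt U0fun (DU0 x) x := by
  have hc := c0_pos
  have h := ((((hasDerivAt_DU0 hx).pow 2).const_add 1).rpow_const (p := -(1:ℝ)/4)
    (Or.inl (by simp only [Pi.pow_apply]; positivity))).const_mul (2 / c0)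
  have heq : U0fun =ᶠ[𝓝 x] fun x => 2 / c0 * (1 + DU0 x ^ 2) ^ (-(1:ℝ)/4) :=
    eventually_of_mem (Ioo_mem_nhds hx.1 hx.2) fun y hy => U0fun_of_mem_Ioo hy
  refine HasDerivAt.congr_of_eventuallyEq ?_ heq
  refine h.congr_deriv ?_
  have hD : DDU0 x = -c0 * (1 + DU0 x ^ 2) ^ ((5:ℝ)/4) := rfl
  have hpos : 0 < 1 + DU0 x ^ 2 := by positivity
  rw [hD, show -(1:ℝ)/4 - 1 = -(5/4) by norm_num]
  simp only [Pi.pow_apply]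
  rw [Real.rpow_neg hpos.le]
  field_simp
  push_cast
  ring

theorem continuousOn_DU0 : ContinuousOn DU0 (Ioo 0 1) :=
  fun _ hx => (hasDerivAt_DU0 hx).continuousAt.continuousWithinAt

theorem continuousOn_DDU0 : ContinuousOn DDU0 (Ioo 0 1) :=
  (((continuous_one_add_sq_rpow ((5:ℝ)/4)).comp_continuousOn continuousOn_DU0).const_mul
    (-c0))

theorem integral_energy_U0 :
    (∫ x in Ioo (0:ℝ) 1, (DDU0 x)^2 / (1 + (DU0 x)^2) ^ ((5:ℝ)/2)) = c0^2 := by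
  have h : ∀ x, (DDU0 x)^2 / (1 + (DU0 x)^2) ^ ((5:ℝ)/2) = c0 ^ 2 := fun x => by
    have hD : DDU0 x = -c0 * (1 + DU0 x ^ 2) ^ ((5:ℝ)/4) := rfl
    have hpos : 0 < 1 + DU0 x ^ 2 := by positivity
    rw [hD, mul_pow, ← Real.rpow_mul_natCast hpos.le, neg_sq,
      show (5:ℝ)/4 * (2 : ℕ) = 5 / 2 by norm_num]
    field_simp
  simp [h]

theorem integral_length_U0 :
    (∫ x in Ioo (0:ℝ) 1, Real.sqrt (1 + (DU0 x)^2))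
      = (1/c0) * ∫ t : ℝ, ((1 + t^2) ^ (-(3:ℝ)/4) : ℝ) := by
  rw [← image_elasticaX, integral_image_eq_integral_abs_deriv_smul measurableSet_Ioo
      (fun φ _ => (hasDerivAt_elasticaX φ).hasDerivWithinAt)
      (strictMonoOn_elasticaX.injOn.mono Ioo_subset_Icc_self),
    integral_one_add_sq_rpow_neg_three_quarters,
    intervalIntegral.integral_of_le Real.pi_pos.le, integral_Ioc_eq_integral_Ioo,
    ← mul_assoc, ← integral_const_mul]
  refine setIntegral_congr_fun measurableSet_Ioo fun φ hφ => ?_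
  have hs := Real.sin_pos_of_mem_Ioo hφ
  have hq := elasticaRoot_pos φ
  have hc := c0_pos
  have hv := elasticaVel_nonneg φ
  simp only [smul_eq_mul]
  rw [abs_of_nonneg (by positivity), DU0_elasticaX hφ, Real.sqrt_eq_rpow,
    one_add_elasticaSlope_sq_rpow hφ,
    show -4 * (1 / (2:ℝ)) = -((2 : ℕ) : ℝ) by norm_num, Real.rpow_neg hs.le, Real.rpow_natCast,
    elasticaVel]
  field_simp

/-- The projection of `ℝ` onto `[0, π]`. -/
def clampPi (τ : ℝ) : ℝ := max 0 (min τ Real.pi)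

theorem continuous_clampPi : Continuous clampPi := by
  unfold clampPi; fun_prop

theorem clampPi_of_nonpos {τ : ℝ} (h : τ ≤ 0) : clampPi τ = 0 :=
  max_eq_left (min_le_of_left_le h)

theorem clampPi_of_mem {τ : ℝ} (h : τ ∈ Icc 0 Real.pi) : clampPi τ = τ := by
  rw [clampPi, min_eq_left h.2, max_eq_right h.1]

theorem clampPi_of_pi_le {τ : ℝ} (h : Real.pi ≤ τ) : clampPi τ = Real.pi := by
  rw [clampPi, min_eq_right h, max_eq_right Real.pi_pos.le]

theorem integral_clampPi_of_nonpos (f : ℝ → ℝ) {τ : ℝ} (h : τ ≤ 0) :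
    ∫ s in (0:ℝ)..τ, f (clampPi s) = f 0 * τ := by
  rw [intervalIntegral.integral_congr (g := fun _ => f 0)]
  · simp [mul_comm]
  · intro s hs
    rw [uIcc_of_ge h] at hs
    simp only [clampPi_of_nonpos hs.2]

theorem integral_clampPi_of_mem (f : ℝ → ℝ) {τ : ℝ} (h : τ ∈ Icc 0 Real.pi) :
    ∫ s in (0:ℝ)..τ, f (clampPi s) = ∫ s in (0:ℝ)..τ, f s := by
  refine intervalIntegral.integral_congr fun s hs => ?_
  rw [uIcc_of_le h.1] at hs
  simp only [clampPi_of_mem ⟨hs.1, hs.2.trans h.2⟩]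

theorem integral_clampPi_of_pi_le {f : ℝ → ℝ} (hf : Continuous f) {τ : ℝ} (h : Real.pi ≤ τ) :
    ∫ s in (0:ℝ)..τ, f (clampPi s)
      = (∫ s in (0:ℝ)..Real.pi, f s) + f Real.pi * (τ - Real.pi) := by
  have hc : Continuous fun s => f (clampPi s) := hf.comp continuous_clampPi
  rw [← intervalIntegral.integral_add_adjacent_intervals
      (hc.intervalIntegrable 0 Real.pi) (hc.intervalIntegrable Real.pi τ),
    integral_clampPi_of_mem f ⟨Real.pi_pos.le, le_rfl⟩]
  congr 1
  rw [intervalIntegral.integral_congr (g := fun _ => f Real.pi)]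
  · simp [mul_comm]
  · intro s hs
    rw [uIcc_of_le h] at hs
    simp only [clampPi_of_pi_le hs.1]

/-- If `f'` vanishes at `0` and `π`, then `f' ∘ clampPi` is the derivative of `f ∘ clampPi`. -/
theorem integral_deriv_clampPi {f f' : ℝ → ℝ} (hf : ∀ τ, HasDerivAt f (f' τ) τ)
    (hf' : Continuous f') (h0 : f' 0 = 0) (hpi : f' Real.pi = 0) (τ : ℝ) :
    ∫ s in (0:ℝ)..τ, f' (clampPi s) = f (clampPi τ) - f 0 := by
  have hFTC : ∀ b, ∫ s in (0:ℝ)..b, f' s = f b - f 0 := fun b =>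
    intervalIntegral.integral_eq_sub_of_hasDerivAt (fun s _ => hf s) (hf'.intervalIntegrable _ _)
  rcases le_total τ 0 with h | h
  · rw [integral_clampPi_of_nonpos f' h, clampPi_of_nonpos h, h0]
    ring
  rcases le_total τ Real.pi with h' | h'
  · rw [integral_clampPi_of_mem f' ⟨h, h'⟩, clampPi_of_mem ⟨h, h'⟩, hFTC]
  · rw [integral_clampPi_of_pi_le hf' h', clampPi_of_pi_le h', hFTC, hpi]
    ring

/-- The parameter of the elastica, extended beyond `[0, π]` along the vertical segments of
length `S`, as an affine function of `t ∈ [0, 1]`. -/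
def comparisonTime (S t : ℝ) : ℝ := (Real.pi + c0 * S) * t - c0 * S / 2

/-- The function `f ∘ clampPi` in the parameter `t`, scaled as a velocity. -/
def comparisonVel (S : ℝ) (f : ℝ → ℝ) (t : ℝ) : ℝ :=
  (Real.pi + c0 * S) * f (clampPi (comparisonTime S t))

theorem continuous_comparisonVel (S : ℝ) {f : ℝ → ℝ} (hf : Continuous f) :
    Continuous (comparisonVel S f) := by
  have := continuous_clampPi
  unfold comparisonVel comparisonTime
  fun_prop

theorem integral_comparisonVel (S : ℝ) (f : ℝ → ℝ) (a b : ℝ) :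
    ∫ t in a..b, comparisonVel S f t
      = ∫ τ in comparisonTime S a..comparisonTime S b, f (clampPi τ) := by
  simp only [comparisonVel, comparisonTime]
  rw [intervalIntegral.integral_const_mul]
  exact intervalIntegral.mul_integral_comp_mul_sub (f := fun τ => f (clampPi τ)) _ _

theorem integral_comparisonVel_sub (S : ℝ) {f : ℝ → ℝ} (hf : Continuous f) (a b : ℝ) :
    ∫ t in a..b, comparisonVel S f t
      = (∫ τ in (0:ℝ)..comparisonTime S b, f (clampPi τ))
        - ∫ τ in (0:ℝ)..comparisonTime S a, f (clampPi τ) := by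
  have hc : Continuous fun τ => f (clampPi τ) := hf.comp continuous_clampPi
  rw [integral_comparisonVel, intervalIntegral.integral_interval_sub_left
    (hc.intervalIntegrable _ _) (hc.intervalIntegrable _ _)]

theorem comparisonVel_eq_add_integral (S : ℝ) {f f' : ℝ → ℝ}
    (hf : ∀ τ, HasDerivAt f (f' τ) τ) (hf' : Continuous f') (h0 : f' 0 = 0)
    (hpi : f' Real.pi = 0) (a t : ℝ) :
    comparisonVel S f t = comparisonVel S f a
      + ∫ s in a..t, (Real.pi + c0 * S) * comparisonVel S f' s := by
  rw [intervalIntegral.integral_const_mul, integral_comparisonVel_sub S hf',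
    integral_deriv_clampPi hf hf' h0 hpi, integral_deriv_clampPi hf hf' h0 hpi,
    comparisonVel, comparisonVel]
  ring

theorem comparisonTime_zero (S : ℝ) : comparisonTime S 0 = -(c0 * S / 2) := by
  simp [comparisonTime]

theorem comparisonTime_one (S : ℝ) : comparisonTime S 1 = Real.pi + c0 * S / 2 := by
  rw [comparisonTime]; ring

theorem integral_comparisonVel_zero {S : ℝ} (hS : 0 ≤ S) {f : ℝ → ℝ} (hf : Continuous f)
    (t : ℝ) :
    ∫ s in (0:ℝ)..t, comparisonVel S f s
      = (∫ τ in (0:ℝ)..comparisonTime S t, f (clampPi τ)) + f 0 * (c0 * S / 2) := by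
  have := mul_nonneg c0_pos.le hS
  rw [integral_comparisonVel_sub S hf, comparisonTime_zero,
    integral_clampPi_of_nonpos f (τ := -(c0 * S / 2)) (by linarith)]
  ring

theorem lintegral_comparisonVel {S : ℝ} (hS : 0 ≤ S) {f : ℝ → ℝ} (hf : Continuous f)
    (hf0 : ∀ φ, 0 ≤ f φ) :
    ∫⁻ t in Ioo (0:ℝ) 1, ENNReal.ofReal (comparisonVel S f t)
      = ENNReal.ofReal (f 0 * (c0 * S / 2) + (∫ φ in (0:ℝ)..Real.pi, f φ)
          + f Real.pi * (c0 * S / 2)) := by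
  have hcS := mul_nonneg c0_pos.le hS
  have hc := continuous_comparisonVel S hf
  rw [← ofReal_integral_eq_lintegral_ofReal
      ((hc.integrableOn_Icc (a := 0) (b := 1)).mono_set Ioo_subset_Icc_self)
      (Eventually.of_forall fun t => mul_nonneg (by positivity) (hf0 _)),
    ← integral_Ioc_eq_integral_Ioo, ← intervalIntegral.integral_of_le zero_le_one,
    integral_comparisonVel_zero hS hf, comparisonTime_one,
    integral_clampPi_of_pi_le hf (by linarith)]
  congr 1
  ring

theorem hasDerivAt_const_mul_elasticaVel (φ : ℝ) :
    HasDerivAt (fun φ => 2 / c0 * elasticaVel φ) (2 / c0 * elasticaAcc φ) φ :=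
  (hasDerivAt_elasticaVel φ).const_mul _

theorem hasDerivAt_const_mul_cos (φ : ℝ) :
    HasDerivAt (fun φ => 2 / c0 * Real.cos φ) (2 / c0 * -Real.sin φ) φ :=
  (Real.hasDerivAt_cos φ).const_mul _

theorem continuous_const_mul_elasticaVel : Continuous fun φ => 2 / c0 * elasticaVel φ :=
  continuous_elasticaVel.const_mul _

theorem continuous_const_mul_cos : Continuous fun φ => 2 / c0 * Real.cos φ :=
  Real.continuous_cos.const_mul _

theorem continuous_const_mul_elasticaAcc : Continuous fun φ => 2 / c0 * elasticaAcc φ :=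
  continuous_elasticaAcc.const_mul _

theorem continuous_const_mul_neg_sin : Continuous fun φ => 2 / c0 * -Real.sin φ :=
  Real.continuous_sin.neg.const_mul _

/-- The concatenation of the vertical segment from `(0, 0)` to `(0, S)`, the graph of `S + U₀`,
and the vertical segment from `(1, S)` to `(1, 0)`. -/
def comparisonCurve (S : ℝ) : Curve where
  x t := ∫ s in (0:ℝ)..t, comparisonVel S (fun φ => 2 / c0 * elasticaVel φ) s
  y t := ∫ s in (0:ℝ)..t, comparisonVel S (fun φ => 2 / c0 * Real.cos φ) s
  dx := comparisonVel S fun φ => 2 / c0 * elasticaVel φ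
  dy := comparisonVel S fun φ => 2 / c0 * Real.cos φ
  ddx s := (Real.pi + c0 * S) * comparisonVel S (fun φ => 2 / c0 * elasticaAcc φ) s
  ddy s := (Real.pi + c0 * S) * comparisonVel S (fun φ => 2 / c0 * -Real.sin φ) s
  dx_int := (continuous_comparisonVel S continuous_const_mul_elasticaVel).integrableOn_Icc
  dy_int := (continuous_comparisonVel S continuous_const_mul_cos).integrableOn_Icc
  ftc_x t _ := by simp
  ftc_y t _ := by simp
  ddx_loc _ _ _ _ := ((continuous_comparisonVel S
    continuous_const_mul_elasticaAcc).const_mul _).integrableOn_Icc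
  ddy_loc _ _ _ _ := ((continuous_comparisonVel S
    continuous_const_mul_neg_sin).const_mul _).integrableOn_Icc
  ftc_dx a _ t _ := comparisonVel_eq_add_integral S hasDerivAt_const_mul_elasticaVel
    continuous_const_mul_elasticaAcc (by simp [elasticaAcc]) (by simp [elasticaAcc]) a t
  ftc_dy a _ t _ := comparisonVel_eq_add_integral S hasDerivAt_const_mul_cos
    continuous_const_mul_neg_sin (by simp) (by simp) a t

section Curve

variable {S : ℝ} (hS : 0 ≤ S)
include hS

theorem comparisonSpeed_pos : 0 < Real.pi + c0 * S := by
  have := c0_pos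
  have := Real.pi_pos
  positivity

theorem comparisonCurve_x (t : ℝ) :
    (comparisonCurve S).x t = elasticaX (clampPi (comparisonTime S t)) := by
  change ∫ s in (0:ℝ)..t, comparisonVel S (fun φ => 2 / c0 * elasticaVel φ) s = _
  rw [integral_comparisonVel_zero hS continuous_const_mul_elasticaVel,
    integral_deriv_clampPi hasDerivAt_elasticaX continuous_const_mul_elasticaVel
      (by simp [elasticaVel]) (by simp [elasticaVel]), elasticaX_zero]
  simp [elasticaVel]

theorem comparisonCurve_y (t : ℝ) :
    (comparisonCurve S).y t
      = S + ∫ τ in (0:ℝ)..comparisonTime S t, 2 / c0 * Real.cos (clampPi τ) := by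
  have := c0_pos
  change ∫ s in (0:ℝ)..t, comparisonVel S (fun φ => 2 / c0 * Real.cos φ) s = _
  rw [integral_comparisonVel_zero hS continuous_const_mul_cos, Real.cos_zero]
  field_simp
  ring

omit hS in
theorem integral_const_mul_cos (τ : ℝ) :
    ∫ s in (0:ℝ)..τ, 2 / c0 * Real.cos s = 2 / c0 * Real.sin τ := by
  simp

theorem comparisonCurve_y_of_nonpos {t : ℝ} (ht : comparisonTime S t ≤ 0) :
    (comparisonCurve S).y t = S + 2 / c0 * comparisonTime S t := by
  rw [comparisonCurve_y hS, integral_clampPi_of_nonpos (fun φ => 2 / c0 * Real.cos φ) ht,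
    Real.cos_zero, mul_one]

theorem comparisonCurve_y_of_mem {t : ℝ} (ht : comparisonTime S t ∈ Icc 0 Real.pi) :
    (comparisonCurve S).y t = S + 2 / c0 * Real.sin (comparisonTime S t) := by
  rw [comparisonCurve_y hS, integral_clampPi_of_mem (fun φ => 2 / c0 * Real.cos φ) ht,
    integral_const_mul_cos]

theorem comparisonCurve_y_of_pi_le {t : ℝ} (ht : Real.pi ≤ comparisonTime S t) :
    (comparisonCurve S).y t = S - 2 / c0 * (comparisonTime S t - Real.pi) := by
  rw [comparisonCurve_y hS, integral_clampPi_of_pi_le continuous_const_mul_cos ht,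
    integral_const_mul_cos, Real.sin_pi, Real.cos_pi]
  ring

theorem comparisonTime_mono : Monotone (comparisonTime S) := fun s t hst => by
  have := mul_le_mul_of_nonneg_left hst (comparisonSpeed_pos hS).le
  simp only [comparisonTime]
  linarith

theorem comparisonTime_nonpos_iff {t : ℝ} :
    comparisonTime S t ≤ 0 ↔ t ≤ c0 * S / 2 / (Real.pi + c0 * S) := by
  rw [le_div_iff₀ (comparisonSpeed_pos hS), comparisonTime, sub_nonpos, mul_comm]

theorem pi_le_comparisonTime_iff {t : ℝ} :
    Real.pi ≤ comparisonTime S t ↔ (c0 * S / 2 + Real.pi) / (Real.pi + c0 * S) ≤ t := by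
  rw [div_le_iff₀ (comparisonSpeed_pos hS), comparisonTime, le_sub_iff_add_le, mul_comm t,
    add_comm]

theorem comparisonTime_mem_Ioo_iff {t : ℝ} :
    comparisonTime S t ∈ Ioo 0 Real.pi ↔ t ∈ Ioo (c0 * S / 2 / (Real.pi + c0 * S))
      ((c0 * S / 2 + Real.pi) / (Real.pi + c0 * S)) := by
  rw [mem_Ioo, mem_Ioo, ← not_le, ← not_le, ← not_le, ← not_le, comparisonTime_nonpos_iff hS,
    pi_le_comparisonTime_iff hS]

theorem comparisonCurve_graph {t : ℝ} (ht : comparisonTime S t ∈ Ioo 0 Real.pi) :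
    (comparisonCurve S).y t = S + U0fun ((comparisonCurve S).x t) := by
  have ht' := Ioo_subset_Icc_self ht
  rw [comparisonCurve_y_of_mem hS ht', comparisonCurve_x hS, clampPi_of_mem ht',
    U0fun_elasticaX ht]

theorem comparisonCurve_dx_nonneg (t : ℝ) : 0 ≤ (comparisonCurve S).dx t :=
  mul_nonneg (comparisonSpeed_pos hS).le
    (mul_nonneg (div_pos two_pos c0_pos).le (elasticaVel_nonneg _))

omit hS in
theorem comparisonTime_mem_of_dx_pos {t : ℝ} (ht : 0 < (comparisonCurve S).dx t) :
    comparisonTime S t ∈ Ioo 0 Real.pi := by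
  change 0 < (Real.pi + c0 * S) * (2 / c0 * elasticaVel (clampPi (comparisonTime S t))) at ht
  refine ⟨not_le.1 fun h => ?_, not_le.1 fun h => ?_⟩
  · simp [clampPi_of_nonpos h, elasticaVel] at ht
  · simp [clampPi_of_pi_le h, elasticaVel] at ht

omit hS in
theorem comparisonCurve_x_zero : (comparisonCurve S).x 0 = 0 := by
  simp [comparisonCurve]

theorem comparisonCurve_x_one : (comparisonCurve S).x 1 = 1 := by
  have := mul_nonneg c0_pos.le hS
  rw [comparisonCurve_x hS, comparisonTime_one, clampPi_of_pi_le (by linarith), elasticaX_pi]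

theorem comparisonCurve_x_mono : Monotone (comparisonCurve S).x := fun s t hst => by
  rw [comparisonCurve_x hS, comparisonCurve_x hS]
  refine strictMonoOn_elasticaX.monotoneOn ?_ ?_
    (max_le_max_left _ (min_le_min_right _ (comparisonTime_mono hS hst))) <;>
  exact ⟨le_max_left _ _, max_le Real.pi_pos.le (min_le_right _ _)⟩

theorem speed1_comparisonCurve (t : ℝ) :
    speed1 (comparisonCurve S).toCurve1 t
      = comparisonVel S (fun φ => 2 / c0 * (1 / elasticaRoot φ)) t := by
  have hκ := comparisonSpeed_pos hS
  have hc := c0_pos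
  have hq := elasticaRoot_pos (clampPi (comparisonTime S t))
  simp only [speed1, comparisonCurve, comparisonVel]
  rw [← Real.sqrt_sq (by positivity : 0 ≤ (Real.pi + c0 * S) *
      (2 / c0 * (1 / elasticaRoot (clampPi (comparisonTime S t)))))]
  congr 1
  simp only [mul_pow, ← elasticaVel_sq_add_cos_sq]
  ring

theorem elInt_comparisonCurve (t : ℝ) :
    elInt (comparisonCurve S) t = comparisonVel S (fun φ => 2 * c0 * elasticaVel φ) t := by
  have hκ := comparisonSpeed_pos hS
  have hc := c0_pos
  have hspeed : ((comparisonCurve S).dx t ^ 2 + (comparisonCurve S).dy t ^ 2) ^ ((5:ℝ)/2)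
      = comparisonVel S (fun φ => 2 / c0 * (1 / elasticaRoot φ)) t ^ 5 := by
    rw [← speed1_comparisonCurve hS, speed1, Real.sqrt_eq_rpow,
      ← Real.rpow_mul_natCast (by positivity)]
    norm_num
  rw [elInt, hspeed]
  simp only [comparisonCurve, comparisonVel]
  set φ := clampPi (comparisonTime S t)
  set κ := Real.pi + c0 * S
  have hq := elasticaRoot_pos φ
  rw [show κ * (2 / c0 * elasticaVel φ) * (κ * (κ * (2 / c0 * -Real.sin φ)))
      - κ * (2 / c0 * Real.cos φ) * (κ * (κ * (2 / c0 * elasticaAcc φ)))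
      = κ ^ 3 * (2 / c0) ^ 2 * (elasticaVel φ * -Real.sin φ - Real.cos φ * elasticaAcc φ) by ring,
    elasticaVel_cross, elasticaVel]
  field_simp

theorem lenE_comparisonCurve :
    lenE (comparisonCurve S) = ENNReal.ofReal (2 * S
      + (1/c0) * ∫ t : ℝ, ((1 + t^2) ^ (-(3:ℝ)/4) : ℝ)) := by
  have hc := c0_pos
  simp only [lenE, len1E, speed1_comparisonCurve hS]
  rw [lintegral_comparisonVel hS, integral_one_add_sq_rpow_neg_three_quarters,
    intervalIntegral.integral_const_mul]
  · congr 1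
    simp only [elasticaRoot, Real.sin_zero, Real.sin_pi]
    norm_num
    field_simp
    ring
  · exact (continuous_const.div continuous_elasticaRoot
      fun φ => (elasticaRoot_pos φ).ne').const_mul _
  · intro φ
    have := elasticaRoot_pos φ
    positivity

theorem elE_comparisonCurve : elE (comparisonCurve S) = ENNReal.ofReal (c0 ^ 2) := by
  simp only [elE, elInt_comparisonCurve hS]
  rw [lintegral_comparisonVel hS (continuous_elasticaVel.const_mul _)
    fun φ => mul_nonneg (mul_pos two_pos c0_pos).le (elasticaVel_nonneg φ)]
  congr 1
  have h := c0_eq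
  rw [intervalIntegral.integral_const_mul]
  simp only [elasticaVel, Real.sin_zero, Real.sin_pi] at h ⊢
  linear_combination -c0 * h

omit hS in
theorem w22locOn_add_U0fun {c d : ℝ} (hc : 0 ≤ c) (hd : d ≤ 1) :
    W22locOn (fun x => S + U0fun x) DU0 DDU0 c d := by
  have hIcc : ∀ {a b : ℝ}, c < a → b < d → Icc a b ⊆ Ioo 0 1 := fun ha hb x hx =>
    ⟨(hc.trans_lt ha).trans_le hx.1, hx.2.trans_lt (hb.trans_le hd)⟩
  have huIcc : ∀ {a t : ℝ}, a ∈ Ioo c d → t ∈ Ioo c d → uIcc a t ⊆ Ioo 0 1 := fun ha ht =>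
    hIcc (lt_min ha.1 ht.1) (max_lt ha.2 ht.2)
  refine ⟨fun a b ha hb => ?_, fun a b ha hb => ?_, fun a b ha hb => ?_,
    fun a ha t ht => ?_, fun a ha t ht => ?_⟩
  · exact (continuousOn_DU0.mono (hIcc ha hb)).integrableOn_Icc
  · exact (continuousOn_DDU0.mono (hIcc ha hb)).integrableOn_Icc
  · exact ((continuousOn_DDU0.mono (hIcc ha hb)).pow 2).integrableOn_Icc
  · rw [intervalIntegral.integral_eq_sub_of_hasDerivAt
      (fun x hx => hasDerivAt_U0fun (huIcc ha ht hx))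
      (continuousOn_DU0.mono (huIcc ha ht)).intervalIntegrable]
    ring
  · rw [intervalIntegral.integral_eq_sub_of_hasDerivAt
      (fun x hx => hasDerivAt_DU0 (huIcc ha ht hx))
      (continuousOn_DDU0.mono (huIcc ha ht)).intervalIntegrable]
    ring

theorem pseudograph_comparisonCurve : Pseudograph (comparisonCurve S) := by
  have hκ := comparisonSpeed_pos hS
  have hc := c0_pos
  refine ⟨⟨(Real.pi + c0 * S) * (2 / c0 * (1 / 2)), by positivity, fun t _ => ?_⟩,
    fun t _ => comparisonCurve_dx_nonneg hS t, fun a b ha _ hb hpos => ?_⟩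
  · rw [speed1_comparisonCurve hS, comparisonVel]
    have := elasticaRoot_pos (clampPi (comparisonTime S t))
    have := elasticaRoot_lt_two (clampPi (comparisonTime S t))
    gcongr
  · refine ⟨_, _, _, w22locOn_add_U0fun (S := S) ?_ ?_, fun t ht =>
      (comparisonCurve_graph hS (comparisonTime_mem_of_dx_pos (hpos t ht))).symm⟩
    · exact comparisonCurve_x_zero.symm.trans_le (comparisonCurve_x_mono hS ha)
    · exact (comparisonCurve_x_mono hS hb).trans_eq (comparisonCurve_x_one hS)

theorem comparisonCurve_y_one : (comparisonCurve S).y 1 = 0 := by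
  have hc := c0_pos
  have := mul_nonneg hc.le hS
  rw [comparisonCurve_y_of_pi_le hS (by rw [comparisonTime_one]; linarith), comparisonTime_one]
  field_simp
  ring

theorem memP_comparisonCurve {ψ : ℝ → ℝ} (h0 : ψ 0 ≤ 0) (h1 : ψ 1 ≤ 0)
    (hψ : ∀ x ∈ Ioo (0:ℝ) 1, ψ x ≤ S) : MemP ψ (comparisonCurve S) := by
  have hc := c0_pos
  refine ⟨pseudograph_comparisonCurve hS, comparisonCurve_x_zero, by simp [comparisonCurve],
    comparisonCurve_x_one hS, comparisonCurve_y_one hS, fun t ht => ?_⟩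
  have hlow := comparisonTime_mono hS ht.1
  have hupp := comparisonTime_mono hS ht.2
  rw [comparisonTime_zero] at hlow
  rw [comparisonTime_one] at hupp
  have hscale : 2 / c0 * (c0 * S / 2) = S := by field_simp
  have hpos : 0 < 2 / c0 := by positivity
  rcases le_or_gt (comparisonTime S t) 0 with h | h
  · rw [comparisonCurve_x hS, clampPi_of_nonpos h, elasticaX_zero,
      comparisonCurve_y_of_nonpos hS h]
    nlinarith
  rcases le_or_gt Real.pi (comparisonTime S t) with h' | h'
  · rw [comparisonCurve_x hS, clampPi_of_pi_le h', elasticaX_pi,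
      comparisonCurve_y_of_pi_le hS h']
    nlinarith
  · rw [comparisonCurve_x hS, comparisonCurve_y_of_mem hS ⟨h.le, h'.le⟩,
      clampPi_of_mem ⟨h.le, h'.le⟩]
    have := mul_pos hpos (Real.sin_pos_of_mem_Ioo ⟨h, h'⟩)
    linarith [hψ _ (elasticaX_mem_Ioo ⟨h, h'⟩)]

end Curve

theorem Admissible.bddAbove_image {ψ : ℝ → ℝ} (h : Admissible ψ) :
    BddAbove (ψ '' Ioo 0 1) :=
  (isCompact_Icc.bddAbove_image h.cont).mono (image_mono Ioo_subset_Icc_self)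

theorem Admissible.sSup_pos {ψ : ℝ → ℝ} (h : Admissible ψ) : 0 < sSup (ψ '' Ioo 0 1) := by
  obtain ⟨x, hx, hpos⟩ := h.pos
  have hx0 : x ≠ 0 := by rintro rfl; exact hpos.not_gt h.neg0
  have hx1 : x ≠ 1 := by rintro rfl; exact hpos.not_gt h.neg1
  exact hpos.trans_le (le_csSup h.bddAbove_image
    (mem_image_of_mem ψ ⟨hx.1.lt_of_ne' hx0, hx.2.lt_of_ne hx1⟩))

/-- The comparison curve built from `U₀` has energy `c₀²` and the stated length. -/
theorem stmt18 :
    -- derivative formulas for U₀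
    (∀ x ∈ Ioo (0:ℝ) 1, HasDerivAt U0fun (DU0 x) x) ∧
    (∀ x ∈ Ioo (0:ℝ) 1, HasDerivAt DU0 (DDU0 x) x) ∧
    -- elastic energy of the graph of U₀
    (∫ x in Ioo (0:ℝ) 1, (DDU0 x)^2 / (1 + (DU0 x)^2) ^ ((5:ℝ)/2)) = c0^2 ∧
    -- length of the graph of U₀
    (∫ x in Ioo (0:ℝ) 1, Real.sqrt (1 + (DU0 x)^2))
      = (1/c0) * ∫ t : ℝ, ((1 + t^2) ^ (-(3:ℝ)/4) : ℝ) ∧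
    -- the concatenated curve lies in P_ψ (after weak reparametrization) with
    -- energy c₀² and the stated length
    (∀ ψ : ℝ → ℝ, Admissible ψ →
      ∃ (γ : Curve) (β₁ β₂ : ℝ),
        MemP ψ γ ∧ 0 ≤ β₁ ∧ β₁ < β₂ ∧ β₂ ≤ 1 ∧
        (∀ t ∈ Icc (0:ℝ) β₁, γ.x t = 0) ∧ (∀ t ∈ Icc β₂ (1:ℝ), γ.x t = 1) ∧
        MonotoneOn γ.y (Icc (0:ℝ) β₁) ∧ AntitoneOn γ.y (Icc β₂ (1:ℝ)) ∧
        γ.y β₁ = sSup (ψ '' Ioo 0 1) ∧ γ.y β₂ = sSup (ψ '' Ioo 0 1) ∧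
        (∀ t ∈ Ioo β₁ β₂, γ.y t = sSup (ψ '' Ioo 0 1) + U0fun (γ.x t)) ∧
        elE γ = ENNReal.ofReal (c0^2) ∧
        lenE γ = ENNReal.ofReal (2 * sSup (ψ '' Ioo 0 1)
          + (1/c0) * ∫ t : ℝ, ((1 + t^2) ^ (-(3:ℝ)/4) : ℝ))) := by
  refine ⟨fun x hx => hasDerivAt_U0fun hx, fun x hx => hasDerivAt_DU0 hx, integral_energy_U0,
    integral_length_U0, fun ψ hψ => ?_⟩
  have hS := hψ.sSup_pos.le
  have hS' := hψ.sSup_pos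
  set S := sSup (ψ '' Ioo 0 1)
  have hc := c0_pos
  have hpi := Real.pi_pos
  have hpos : 0 < 2 / c0 := by positivity
  have hleft : ∀ t ∈ Icc (0:ℝ) (c0 * S / 2 / (Real.pi + c0 * S)), comparisonTime S t ≤ 0 :=
    fun t ht => (comparisonTime_nonpos_iff hS).2 ht.2
  have hright : ∀ t ∈ Icc ((c0 * S / 2 + Real.pi) / (Real.pi + c0 * S)) (1:ℝ),
      Real.pi ≤ comparisonTime S t := fun t ht => (pi_le_comparisonTime_iff hS).2 ht.1
  have hβ₁ : comparisonTime S (c0 * S / 2 / (Real.pi + c0 * S)) = 0 := by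
    rw [comparisonTime]; field_simp; ring
  have hβ₂ : comparisonTime S ((c0 * S / 2 + Real.pi) / (Real.pi + c0 * S)) = Real.pi := by
    rw [comparisonTime]; field_simp; ring
  refine ⟨comparisonCurve S, c0 * S / 2 / (Real.pi + c0 * S),
    (c0 * S / 2 + Real.pi) / (Real.pi + c0 * S),
    memP_comparisonCurve hS hψ.neg0.le hψ.neg1.le
      fun x hx => le_csSup hψ.bddAbove_image (mem_image_of_mem ψ hx),
    by positivity, by gcongr; linarith, ?_, fun t ht => ?_, fun t ht => ?_,
    fun s hs t ht hst => ?_, fun s hs t ht hst => ?_, ?_, ?_, fun t ht => ?_,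
    elE_comparisonCurve hS, lenE_comparisonCurve hS⟩
  · rw [div_le_one (comparisonSpeed_pos hS)]
    nlinarith
  · rw [comparisonCurve_x hS, clampPi_of_nonpos (hleft t ht), elasticaX_zero]
  · rw [comparisonCurve_x hS, clampPi_of_pi_le (hright t ht), elasticaX_pi]
  · rw [comparisonCurve_y_of_nonpos hS (hleft s hs), comparisonCurve_y_of_nonpos hS (hleft t ht)]
    have := comparisonTime_mono hS hst
    gcongr
  · rw [comparisonCurve_y_of_pi_le hS (hright s hs), comparisonCurve_y_of_pi_le hS (hright t ht)]
    have := comparisonTime_mono hS hst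
    gcongr
  · rw [comparisonCurve_y_of_nonpos hS hβ₁.le, hβ₁]
    ring
  · rw [comparisonCurve_y_of_pi_le hS hβ₂.ge, hβ₂]
    ring
  · exact comparisonCurve_graph hS ((comparisonTime_mem_Ioo_iff hS).2 ht)
end
end
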